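/- arXiv:1312.6930 — 5 statements merged into one kernel-verified Lean document; each statement's English description precedes it below -/
import Mathlib

section
/- Let A be a commutative (multiplicatively written) group, n ≥ 2, and let φ : Fin n → Fin n → (Fin n → ℤ) → A be a system of maps (written φ_{ij}(k) for i ≠ j) satisfying: (1) φ_{ij}(k ∘ w⁻¹) = φ_{w⁻¹ i, w⁻¹ j}(k) for every w ∈ Equiv.Perm (Fin n), every k : Fin n → ℤ and all i ≠ j; and (2) φ_{ji}(k) · φ_{ij}(k) = 1 for all i ≠ j and all k. Define φ_w(k) = ∏_{(i,j) : i < j ∧ w i > w j} φ_{ij}(k). Then for all w', w ∈ Equiv.Perm (Fin n) and all k : Fin n → ℤ, φ_{w'w}(k) = φ_{w'}(k ∘ w⁻¹) · φ_w(k). -/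
open Finset

/-- `φ_w(k)`: the product of `φ_{ij}(k)` over all inversions of `w`. -/
def phiW {A : Type*} [CommGroup A] {n : ℕ}
    (φ : Fin n → Fin n → (Fin n → ℤ) → A) (w : Equiv.Perm (Fin n)) (k : Fin n → ℤ) : A :=
  ∏ p ∈ Finset.univ.filter (fun p : Fin n × Fin n => p.1 < p.2 ∧ w p.2 < w p.1),
    φ p.1 p.2 k

/-- Claim 3.1(a): the cocycle property `φ_{w'w}(k) = φ_{w'}(w(k)) · φ_w(k)`. -/
theorem phiW_mul
    (A : Type*) [CommGroup A] (n : ℕ) (hn : 2 ≤ n)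
    (φ : Fin n → Fin n → (Fin n → ℤ) → A)
    (h1 : ∀ (w : Equiv.Perm (Fin n)) (k : Fin n → ℤ) (i j : Fin n), i ≠ j →
      φ i j (fun x => k (w⁻¹ x)) = φ (w⁻¹ i) (w⁻¹ j) k)
    (h2 : ∀ (k : Fin n → ℤ) (i j : Fin n), i ≠ j → φ j i k * φ i j k = 1) :
    ∀ (w' w : Equiv.Perm (Fin n)) (k : Fin n → ℤ),
      phiW φ (w' * w) k = phiW φ w' (fun x => k (w⁻¹ x)) * phiW φ w k := by
  intro w' w k
  have hreindex : phiW φ w' (fun x => k (w⁻¹ x)) =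
      ∏ p : Fin n × Fin n,
        if w p.1 < w p.2 ∧ w' (w p.2) < w' (w p.1) then φ p.1 p.2 k else 1 := by
    rw [phiW, Finset.prod_filter, ← Equiv.prod_comp (Equiv.prodCongr w w)]
    refine Finset.prod_congr rfl fun p _ => ?_
    simp only [Equiv.prodCongr_apply, Prod.map_fst, Prod.map_snd]
    split_ifs with h
    · simpa using h1 w k _ _ h.1.ne
    · rfl
  -- Pairs `(a, b)` with `b < a` are swapped so that all factors are indexed by `a < b`.
  have hsplit : phiW φ w' (fun x => k (w⁻¹ x)) =
      (∏ p : Fin n × Fin n,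
        if p.1 < p.2 ∧ w p.1 < w p.2 ∧ w' (w p.2) < w' (w p.1) then φ p.1 p.2 k else 1) *
      ∏ p : Fin n × Fin n,
        if p.1 < p.2 ∧ w p.2 < w p.1 ∧ w' (w p.1) < w' (w p.2) then φ p.2 p.1 k else 1 := by
    have hswap : (∏ p : Fin n × Fin n,
        if p.1 < p.2 ∧ w p.2 < w p.1 ∧ w' (w p.1) < w' (w p.2) then φ p.2 p.1 k else 1) =
        ∏ p : Fin n × Fin n,
          if p.2 < p.1 ∧ w p.1 < w p.2 ∧ w' (w p.2) < w' (w p.1) then φ p.1 p.2 k else 1 :=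
      Fintype.prod_equiv (Equiv.prodComm (Fin n) (Fin n)) _ _ fun _ => rfl
    rw [hreindex, hswap, ← Finset.prod_mul_distrib]
    refine Finset.prod_congr rfl fun p _ => ?_
    rcases lt_trichotomy p.1 p.2 with h | h | h
    · simp [h, h.not_gt]
    · simp [h]
    · simp [h, h.not_gt]
  rw [hsplit, phiW, phiW, Finset.prod_filter, Finset.prod_filter, ← Finset.prod_mul_distrib,
    ← Finset.prod_mul_distrib]
  refine Finset.prod_congr rfl fun p _ => ?_
  simp only [Equiv.Perm.mul_apply]
  by_cases hp : p.1 < p.2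
  · have hw : w p.1 ≠ w p.2 := w.injective.ne hp.ne
    have hw' : w' (w p.1) ≠ w' (w p.2) := w'.injective.ne hw
    rcases lt_or_gt_of_ne hw with h | h <;> rcases lt_or_gt_of_ne hw' with h' | h' <;>
      simp [hp, h, h', h.not_gt, h'.not_gt, h2 k p.1 p.2 hp.ne]
  · simp [hp]
end

section
/- Let A be a commutative (multiplicatively written) group, n ≥ 2, let a : Fin n → Fin n → A satisfy a_{ij} = a_{ji} for all i, j, and let φ_{ij} : (Fin n → ℤ) → A (for i ≠ j) satisfy conditions (1) φ_{ij}(k ∘ w⁻¹) = φ_{w⁻¹ i, w⁻¹ j}(k) for every permutation w, (2) φ_{ji}(k) · φ_{ij}(k) = 1, and additionally (3) φ_{ij}(k + k') = a_{ij}^{(k i)·(k' j) − (k' i)·(k j)} · φ_{ij}(k) · φ_{ij}(k') for all k, k' : Fin n → ℤ (integer powers in A). Define φ_w(k) = ∏_{(i,j) : i < j ∧ w i > w j} φ_{ij}(k) and ⟨k, k'⟩ = ∏_{(i,j) : i < j} a_{ij}^{(k' i)·(k j)}. Then for every w ∈ Equiv.Perm (Fin n) and all k, k' : Fin n → ℤ,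 ⟨k, k'⟩ · φ_w(k + k') = ⟨k ∘ w⁻¹, k' ∘ w⁻¹⟩ · φ_w(k) · φ_w(k'). -/
open Finset

/-- The pairing `⟨k, k'⟩ = ∏_{i<j} a_{ij}^{(k' i)·(k j)}`. -/
def pairA {A : Type*} [CommGroup A] {n : ℕ}
    (a : Fin n → Fin n → A) (k k' : Fin n → ℤ) : A :=
  ∏ p ∈ Finset.univ.filter (fun p : Fin n × Fin n => p.1 < p.2),
    a p.1 p.2 ^ (k' p.1 * k p.2)

/-- The structure constants `a` of a permutation-equivariant cocycle are permutation invariant. -/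
theorem structureConst_perm_invariant {A : Type*} [CommGroup A] {n : ℕ}
    {a : Fin n → Fin n → A} {φ : Fin n → Fin n → (Fin n → ℤ) → A}
    (h1 : ∀ (w : Equiv.Perm (Fin n)) (k : Fin n → ℤ) (i j : Fin n), i ≠ j →
      φ i j (fun x => k (w⁻¹ x)) = φ (w⁻¹ i) (w⁻¹ j) k)
    (h3 : ∀ (k k' : Fin n → ℤ) (i j : Fin n), i ≠ j →
      φ i j (k + k') = a i j ^ (k i * k' j - k' i * k j) * φ i j k * φ i j k')
    (w : Equiv.Perm (Fin n)) {i j : Fin n} (hij : i ≠ j) : a (w i) (w j) = a i j := by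
  have hw : w i ≠ w j := w.injective.ne hij
  have e := h1 w (Pi.single i 1 + Pi.single j 1) (w i) (w j) hw
  have e' := h3 (fun x => (Pi.single i 1 : Fin n → ℤ) (w⁻¹ x))
    (fun x => (Pi.single j 1 : Fin n → ℤ) (w⁻¹ x)) (w i) (w j) hw
  rw [h1 w _ _ _ hw, h1 w _ _ _ hw] at e'
  simp only [Equiv.Perm.inv_def, Equiv.symm_apply_apply] at e e'
  rw [h3 _ _ _ _ hij] at e
  have key := e'.symm.trans e
  simpa [hij, hij.symm] using key

/-- Reindexing a product over increasing pairs by a permutation, reordering each image pair. -/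
theorem prod_increasing_pairs_perm {A : Type*} [CommMonoid A] {n : ℕ}
    (w : Equiv.Perm (Fin n)) (f : Fin n → Fin n → A) :
    ∏ p : Fin n × Fin n with p.1 < p.2, f p.1 p.2 =
      ∏ p : Fin n × Fin n with p.1 < p.2,
        if w p.2 < w p.1 then f (w p.2) (w p.1) else f (w p.1) (w p.2) := by
  let sortedImage (v : Equiv.Perm (Fin n)) (p : Fin n × Fin n) : Fin n × Fin n :=
    if v p.2 < v p.1 then (v p.2, v p.1) else (v p.1, v p.2)
  have hmem (v : Equiv.Perm (Fin n)) (p : Fin n × Fin n) (hp : p.1 < p.2) :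
      (sortedImage v p).1 < (sortedImage v p).2 := by
    have := v.injective.ne hp.ne
    simp only [sortedImage]
    split_ifs with h
    · exact h
    · exact lt_of_le_of_ne (not_lt.mp h) this
  have hinv (v : Equiv.Perm (Fin n)) (p : Fin n × Fin n) (hp : p.1 < p.2) :
      sortedImage v⁻¹ (sortedImage v p) = p := by
    simp only [sortedImage]
    split_ifs <;> simp_all [not_lt_of_gt]
  refine (Finset.prod_bij' (fun p _ => sortedImage w p) (fun p _ => sortedImage w⁻¹ p)
    ?_ ?_ ?_ ?_ ?_).symm
  · simpa using fun i j => hmem w (i, j)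
  · simpa using fun i j => hmem w⁻¹ (i, j)
  · simpa using fun i j => hinv w (i, j)
  · simpa using fun i j => hinv w⁻¹ (i, j)
  · intro p _
    simp only [sortedImage]
    split_ifs <;> rfl

/-- Claim 3.1(b): `⟨k,k'⟩ · φ_w(k+k') = ⟨w(k), w(k')⟩ · φ_w(k) · φ_w(k')`. -/
theorem phiW_twisted_multiplicativity
    (A : Type*) [CommGroup A] (n : ℕ) (hn : 2 ≤ n)
    (a : Fin n → Fin n → A) (ha : ∀ i j, a i j = a j i)
    (φ : Fin n → Fin n → (Fin n → ℤ) → A)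
    (h1 : ∀ (w : Equiv.Perm (Fin n)) (k : Fin n → ℤ) (i j : Fin n), i ≠ j →
      φ i j (fun x => k (w⁻¹ x)) = φ (w⁻¹ i) (w⁻¹ j) k)
    (h2 : ∀ (k : Fin n → ℤ) (i j : Fin n), i ≠ j → φ j i k * φ i j k = 1)
    (h3 : ∀ (k k' : Fin n → ℤ) (i j : Fin n), i ≠ j →
      φ i j (k + k') = a i j ^ (k i * k' j - k' i * k j) * φ i j k * φ i j k') :
    ∀ (w : Equiv.Perm (Fin n)) (k k' : Fin n → ℤ),
      pairA a k k' * phiW φ w (k + k') =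
        pairA a (fun x => k (w⁻¹ x)) (fun x => k' (w⁻¹ x)) * phiW φ w k * phiW φ w k' := by
  intro w k k'
  simp only [pairA, phiW]
  rw [prod_increasing_pairs_perm w fun i j => a i j ^ (k' (w⁻¹ i) * k (w⁻¹ j))]
  simp only [← Finset.filter_filter, Finset.prod_filter (fun p : Fin n × Fin n => w p.2 < w p.1),
    ← Finset.prod_mul_distrib]
  refine Finset.prod_congr rfl fun p hp => ?_
  have hlt : p.1 < p.2 := by simpa using hp
  have hne := hlt.ne
  simp only [Equiv.Perm.inv_def, Equiv.symm_apply_apply, structureConst_perm_invariant h1 h3 w hne,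
    structureConst_perm_invariant h1 h3 w hne.symm]
  split_ifs
  · rw [h3 k k' _ _ hne, ha p.2 p.1, ← mul_assoc, ← mul_assoc, ← zpow_add]
    congr 3
    ring
  · simp
end

section
/- Let n ≥ 2 and c ∈ ℂˣ. Then for all w, w' ∈ Equiv.Perm (Fin n): (i) Q_w^{(c)} · Q_w^{(c⁻¹)} = 1 in MonoidAlgebra ℂ T, and (ii) Q_{w'w}^{(c)} = (w⁻¹ • Q_{w'}^{(c)}) · Q_w^{(c)}, where w⁻¹ • (−) is the action of w⁻¹ on MonoidAlgebra ℂ T induced by the permutation action on T. -/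
open MvPolynomial Finset

noncomputable section

/-- The diagonal torus: `n`-tuples of nonzero complex numbers. -/
abbrev Torus (n : ℕ) := Fin n → ℂˣ

/-- The permutation action of the symmetric group on the torus: `(w • t) i = t (w⁻¹ i)`. -/
def permAut (n : ℕ) : Equiv.Perm (Fin n) →* MulAut (Torus n) where
  toFun w := MulEquiv.arrowCongr w (MulEquiv.refl ℂˣ)
  map_one' := rfl
  map_mul' _ _ := rfl

/-- `𝔾ₙ`, the group of monomial matrices, as the semidirect product
`(Fin n → ℂˣ) ⋊ Equiv.Perm (Fin n)`. -/
abbrev Gn (n : ℕ) := Torus n ⋊[permAut n] Equiv.Perm (Fin n)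

/-- The set of inversions of a permutation `w`: pairs `(i,j)` with `i < j` and `w i > w j`. -/
def invFinset (n : ℕ) (w : Equiv.Perm (Fin n)) : Finset (Fin n × Fin n) :=
  Finset.univ.filter fun p : Fin n × Fin n => p.1 < p.2 ∧ w p.2 < w p.1

/-- `τ_i`: the element of the torus equal to `−1` in position `i` and `1` elsewhere. -/
def tau (n : ℕ) (i : Fin n) : Torus n := fun j => if j = i then -1 else 1

/-- The element `Q_{ij}^{(c)}` of the group algebra of the torus. -/
def Qij (n : ℕ) (c : ℂˣ) (i j : Fin n) : MonoidAlgebra ℂ (Torus n) :=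
  (4 : ℂ)⁻¹ •
    (((c : ℂ) + ((c⁻¹ : ℂˣ) : ℂ)) •
        (1 - MonoidAlgebra.of ℂ (Torus n) (tau n i) * MonoidAlgebra.of ℂ (Torus n) (tau n j)) +
      ((c : ℂ) - ((c⁻¹ : ℂˣ) : ℂ) + 2) • MonoidAlgebra.of ℂ (Torus n) (tau n i) +
      (((c⁻¹ : ℂˣ) : ℂ) - (c : ℂ) + 2) • MonoidAlgebra.of ℂ (Torus n) (tau n j))

/-- `Q_w^{(c)}`: the product of `Q_{ij}^{(c)}` over all inversions of `w`. -/
def Qw (n : ℕ) (c : ℂˣ) (w : Equiv.Perm (Fin n)) : MonoidAlgebra ℂ (Torus n) :=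
  ∏ p ∈ invFinset n w, Qij n c p.1 p.2

theorem tau_mul_self (n : ℕ) (i : Fin n) : tau n i * tau n i = 1 := by
  funext j
  by_cases h : j = i <;> simp [tau, h]

theorem permAut_inv_tau (n : ℕ) (w : Equiv.Perm (Fin n)) (i : Fin n) :
    permAut n w⁻¹ (tau n (w i)) = tau n i := by
  funext j
  change (if w j = w i then (-1 : ℂˣ) else 1) = if j = i then -1 else 1
  simp only [EmbeddingLike.apply_eq_iff_eq]

theorem domCongr_Qij (n : ℕ) (c : ℂˣ) (w : Equiv.Perm (Fin n)) (i j : Fin n) :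
    MonoidAlgebra.domCongr ℂ ℂ (permAut n w⁻¹) (Qij n c (w i) (w j)) = Qij n c i j := by
  have key (k : Fin n) : MonoidAlgebra.domCongr ℂ ℂ (permAut n w⁻¹)
      (MonoidAlgebra.of ℂ (Torus n) (tau n (w k))) = MonoidAlgebra.of ℂ (Torus n) (tau n k) := by
    rw [MonoidAlgebra.of_apply, MonoidAlgebra.domCongr_single, permAut_inv_tau,
      MonoidAlgebra.of_apply]
  simp only [Qij, map_smul, map_add, map_sub, map_mul, map_one, key]

theorem Qij_inv (n : ℕ) (c : ℂˣ) (i j : Fin n) : Qij n c⁻¹ i j = Qij n c j i := by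
  simp only [Qij, inv_inv]
  rw [mul_comm (MonoidAlgebra.of ℂ (Torus n) (tau n i)), add_comm (c : ℂ), add_right_comm]

theorem Qij_mul_swap (n : ℕ) (c : ℂˣ) (i j : Fin n) : Qij n c i j * Qij n c j i = 1 := by
  have sq (k : Fin n) : MonoidAlgebra.of ℂ (Torus n) (tau n k) *
      MonoidAlgebra.of ℂ (Torus n) (tau n k) = 1 := by
    rw [← map_mul, tau_mul_self, map_one]
  have hA := sq i
  have hB := sq j
  have hC : algebraMap ℂ (MonoidAlgebra ℂ (Torus n)) c *
      algebraMap ℂ (MonoidAlgebra ℂ (Torus n)) ((c⁻¹ : ℂˣ) : ℂ) = 1 := by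
    rw [← map_mul, Units.mul_inv, map_one]
  have hq : algebraMap ℂ (MonoidAlgebra ℂ (Torus n)) (4 : ℂ)⁻¹ * 4 = 1 := by
    rw [← map_ofNat (algebraMap ℂ (MonoidAlgebra ℂ (Torus n))) 4, ← map_mul,
      inv_mul_cancel₀ (by norm_num), map_one]
  simp only [Qij, Algebra.smul_def, map_add, map_sub, map_ofNat]
  generalize MonoidAlgebra.of ℂ (Torus n) (tau n i) = A at *
  generalize MonoidAlgebra.of ℂ (Torus n) (tau n j) = B at *
  generalize algebraMap ℂ (MonoidAlgebra ℂ (Torus n)) c = C at *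
  generalize algebraMap ℂ (MonoidAlgebra ℂ (Torus n)) ((c⁻¹ : ℂˣ) : ℂ) = C' at *
  generalize algebraMap ℂ (MonoidAlgebra ℂ (Torus n)) (4 : ℂ)⁻¹ = q at *
  clear sq
  grind

/-- A product over the inversions of `w`, as a product over all pairs. -/
theorem prod_invFinset {M : Type*} [CommMonoid M] (n : ℕ) (w : Equiv.Perm (Fin n))
    (f : Fin n → Fin n → M) :
    ∏ p ∈ invFinset n w, f p.1 p.2 =
      ∏ p : Fin n × Fin n, if p.1 < p.2 ∧ w p.2 < w p.1 then f p.1 p.2 else 1 := by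
  rw [invFinset, Finset.prod_filter]

/-- Products over inversions satisfy the cocycle identity as soon as exchanging the two
indices inverts the factor. -/
theorem prod_invFinset_mul {M : Type*} [CommMonoid M] (n : ℕ) (w w' : Equiv.Perm (Fin n))
    (f g : Fin n → Fin n → M) (hf : ∀ i j, f i j * f j i = 1)
    (hg : ∀ i j, g (w i) (w j) = f i j) :
    ∏ p ∈ invFinset n (w' * w), f p.1 p.2 =
      (∏ p ∈ invFinset n w', g p.1 p.2) * ∏ p ∈ invFinset n w, f p.1 p.2 := by
  have hsplit : ∏ p ∈ invFinset n w', g p.1 p.2 =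
      (∏ p : Fin n × Fin n,
        if p.1 < p.2 ∧ w p.1 < w p.2 ∧ w' (w p.2) < w' (w p.1) then f p.1 p.2 else 1) *
      ∏ p : Fin n × Fin n,
        if p.1 < p.2 ∧ w p.2 < w p.1 ∧ w' (w p.1) < w' (w p.2) then f p.2 p.1 else 1 := by
    rw [prod_invFinset, ← (Equiv.prodCongr w w).prod_comp,
      ← (Equiv.prodComm (Fin n) (Fin n)).prod_comp (fun p : Fin n × Fin n =>
        if p.1 < p.2 ∧ w p.2 < w p.1 ∧ w' (w p.1) < w' (w p.2) then f p.2 p.1 else 1),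
      ← Finset.prod_mul_distrib]
    refine Finset.prod_congr rfl fun ⟨i, j⟩ _ => ?_
    simp only [Equiv.prodCongr_apply, Prod.map, Equiv.prodComm_apply, Prod.swap, hg]
    rcases lt_trichotomy i j with h | rfl | h
    · simp [h, h.not_gt]
    · simp
    · simp [h, h.not_gt]
  rw [hsplit, prod_invFinset, prod_invFinset, ← Finset.prod_mul_distrib,
    ← Finset.prod_mul_distrib]
  refine Finset.prod_congr rfl fun ⟨i, j⟩ _ => ?_
  simp only [Equiv.Perm.mul_apply]
  by_cases hij : i < j
  · rcases lt_or_gt_of_ne (w.injective.ne hij.ne) with h | h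
    · simp [hij, h, h.not_gt]
    · rcases lt_or_gt_of_ne (w'.injective.ne h.ne) with h' | h'
      · simp [hij, h, h.not_gt, h', h'.not_gt]
      · simp [hij, h, h.not_gt, h', h'.not_gt, hf]
  · simp [hij]

/-- Lemma 3.3: `Q_w^{(c)} Q_w^{(c⁻¹)} = 1` and `Q_{w'w}^{(c)} = w⁻¹(Q_{w'}^{(c)}) · Q_w^{(c)}`. -/
theorem Qw_inv_mul_and_cocycle (n : ℕ) (hn : 2 ≤ n) (c : ℂˣ)
    (w w' : Equiv.Perm (Fin n)) :
    Qw n c w * Qw n c⁻¹ w = 1 ∧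
    Qw n c (w' * w) =
      MonoidAlgebra.domCongr ℂ ℂ (permAut n w⁻¹) (Qw n c w') * Qw n c w := by
  refine ⟨?_, ?_⟩
  · rw [Qw, Qw, ← Finset.prod_mul_distrib]
    exact Finset.prod_eq_one fun p _ => by rw [Qij_inv, Qij_mul_swap]
  · rw [Qw, Qw, Qw, map_prod]
    exact prod_invFinset_mul n w w' (Qij n c)
      (fun i j => MonoidAlgebra.domCongr ℂ ℂ (permAut n w⁻¹) (Qij n c i j))
      (Qij_mul_swap n c) (domCongr_Qij n c w)

end
end

section
/- Let R be the subring Algebra.adjoin ℤ {(1 + Complex.I)/2} of ℂ. Let n ≥ 2, let m be an even positive integer and let p divide m. Then the group algebras MonoidAlgebra R G(m,p,n) and MonoidAlgebra R W(m,p,n) are isomorphic as R-algebras; in particular MonoidAlgebra ℂ G(m,p,n) and MonoidAlgebra ℂ W(m,p,n) are isomorphic as ℂ-algebras. -/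
open MvPolynomial Finset

noncomputable section

/-- The subgroup of `m`-th roots of unity in `ℂˣ`. -/
def Cgrp (m : ℕ) : Subgroup ℂˣ where
  carrier := {z : ℂˣ | z ^ m = 1}
  one_mem' := one_pow m
  mul_mem' := by
    intro a b ha hb
    simp only [Set.mem_setOf_eq] at *
    rw [mul_pow, ha, hb, mul_one]
  inv_mem' := by
    intro a ha
    simp only [Set.mem_setOf_eq] at *
    rw [inv_pow, ha, inv_one]

/-- The sign character of the symmetric group, valued in `ℂˣ`. -/
def sgn (n : ℕ) : Equiv.Perm (Fin n) →* ℂˣ :=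
  (Units.map (Int.castRingHom ℂ).toMonoidHom).comp Equiv.Perm.sign

/-- The product of the torus components, as a character of `𝔾ₙ`. -/
def detT (n : ℕ) : Gn n →* ℂˣ where
  toFun g := ∏ i, g.left i
  map_one' := by simp
  map_mul' g h := by
    show (∏ i, (g.left i * h.left (g.right⁻¹ i))) = _
    rw [Finset.prod_mul_distrib]
    congr 1
    exact Equiv.prod_comp (g.right⁻¹ : Equiv.Perm _) h.left

/-- The determinant character of `𝔾ₙ`: the sign of the permutation part times the product
of the torus entries. -/
def detC (n : ℕ) : Gn n →* ℂˣ :=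
  ((sgn n).comp (SemidirectProduct.rightHom)) * detT n

/-- The subgroup of `𝔾ₙ` of elements whose torus part has all entries in `C`. -/
def TorusSub (n : ℕ) (C : Subgroup ℂˣ) : Subgroup (Gn n) where
  carrier := {g | ∀ i, g.left i ∈ C}
  one_mem' := by intro i; simp only [SemidirectProduct.one_left]; exact C.one_mem
  mul_mem' := by
    intro a b ha hb i
    exact C.mul_mem (ha i) (hb _)
  inv_mem' := by
    intro a ha i
    show (a⁻¹).left i ∈ C
    rw [SemidirectProduct.inv_left]
    exact C.inv_mem (ha _)

/-- The group `{(t,w) : (∀ i, t i ∈ C) ∧ ∏ i, t i ∈ C'}`; for `C = Cₘ`, `C' = C_{m/p}`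
this is the complex reflection group `G(m,p,n)`. -/
def GG (n : ℕ) (C C' : Subgroup ℂˣ) : Subgroup (Gn n) :=
  TorusSub n C ⊓ Subgroup.comap (detT n) C'

/-- The group `{(t,w) : (∀ i, t i ∈ C) ∧ sign w · ∏ i, t i ∈ C'}`; for `C = Cₘ`,
`C' = C_{m/p}` this is the mystic reflection group `W(m,p,n)`. -/
def WW (n : ℕ) (C C' : Subgroup ℂˣ) : Subgroup (Gn n) :=
  TorusSub n C ⊓ Subgroup.comap (detC n) C'

/-- The complex reflection group `G(m,p,n)` as a subgroup of `𝔾ₙ`. -/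
def Gmpn (m p n : ℕ) : Subgroup (Gn n) := GG n (Cgrp m) (Cgrp (m / p))

/-- The mystic reflection group `W(m,p,n)` as a subgroup of `𝔾ₙ`. -/
def Wmpn (m p n : ℕ) : Subgroup (Gn n) := WW n (Cgrp m) (Cgrp (m / p))

set_option maxHeartbeats 2000000
set_option synthInstance.maxHeartbeats 1000000

/-- The ring `R = ℤ[(1+i)/2]`, the smallest subring of `ℂ` containing `(1+i)/2`. -/
def Rring : Subalgebra ℤ ℂ := Algebra.adjoin ℤ {(1 + Complex.I) / 2}

section InversionProduct

variable {n : ℕ} {M : Type*} [CommMonoid M]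

/-- The product of `u i j` over the pairs `i < j` whose order is reversed by `w⁻¹`. -/
def invProd (u : Fin n → Fin n → M) (w : Equiv.Perm (Fin n)) : M :=
  ∏ j, ∏ i ∈ Iio j, if w.symm i < w.symm j then 1 else u i j

lemma invProd_one (u : Fin n → Fin n → M) : invProd u 1 = 1 :=
  prod_eq_one fun _ _ => prod_eq_one fun _ hi => if_pos (mem_Iio.mp hi)

lemma map_invProd {N : Type*} [CommMonoid N] (f : M →* N) (u : Fin n → Fin n → M)
    (w : Equiv.Perm (Fin n)) : f (invProd u w) = invProd (fun i j => f (u i j)) w := by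
  simp only [invProd, map_prod, apply_ite f, map_one]

lemma invProd_mul_invProd_eq_one {u v : Fin n → Fin n → M}
    (h : ∀ i j, i ≠ j → u i j * v i j = 1) (w : Equiv.Perm (Fin n)) :
    invProd u w * invProd v w = 1 := by
  simp only [invProd, ← prod_mul_distrib]
  refine prod_eq_one fun j _ => prod_eq_one fun i hi => ?_
  split_ifs
  · exact one_mul 1
  · exact h i j (mem_Iio.mp hi).ne

/-- A product of a symmetric function over all pairs `i < j` is invariant under permutations. -/
lemma prod_Iio_comp_of_symm {F : Fin n → Fin n → M} (hF : ∀ i j, F i j = F j i)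
    (σ : Equiv.Perm (Fin n)) :
    ∏ j, ∏ i ∈ Iio j, F (σ i) (σ j) = ∏ j, ∏ i ∈ Iio j, F i j := by
  have key (τ : Equiv.Perm (Fin n)) (x : (_ : Fin n) × Fin n) (hx : x.2 < x.1) :
      τ x.1 ⊓ τ x.2 < τ x.1 ⊔ τ x.2 :=
    inf_lt_sup.mpr (τ.injective.ne hx.ne')
  have inverse (τ : Equiv.Perm (Fin n)) (x : (_ : Fin n) × Fin n) (hx : x.2 < x.1) :
      (⟨τ.symm (τ x.1 ⊔ τ x.2) ⊔ τ.symm (τ x.1 ⊓ τ x.2),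
        τ.symm (τ x.1 ⊔ τ x.2) ⊓ τ.symm (τ x.1 ⊓ τ x.2)⟩ : (_ : Fin n) × Fin n) = x := by
    rcases le_total (τ x.1) (τ x.2) with h | h <;> simp [h, hx.le]
  rw [prod_sigma', prod_sigma']
  refine prod_bij' (fun x _ => ⟨σ x.1 ⊔ σ x.2, σ x.1 ⊓ σ x.2⟩)
    (fun x _ => ⟨σ.symm x.1 ⊔ σ.symm x.2, σ.symm x.1 ⊓ σ.symm x.2⟩) ?_ ?_ ?_ ?_ ?_
  · intro x hx
    simpa using key σ x (by simpa using hx)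
  · intro x hx
    simpa using key σ.symm x (by simpa using hx)
  · intro x hx
    exact inverse σ x (by simpa using hx)
  · intro x hx
    exact inverse σ.symm x (by simpa using hx)
  · intro x hx
    rcases le_total (σ x.1) (σ x.2) with h | h
    · simp only [sup_eq_right.mpr h, inf_eq_left.mpr h]
      exact hF _ _
    · simp only [sup_eq_left.mpr h, inf_eq_right.mpr h]

/-- The cocycle identity for products over inversions. -/
lemma invProd_mul {u : Fin n → Fin n → M} (hu : ∀ i j, i ≠ j → u i j * u j i = 1)
    (v w : Equiv.Perm (Fin n)) :
    invProd u (v * w) = invProd u v * invProd (fun i j => u (v i) (v j)) w := by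
  let F : Fin n → Fin n → M := fun x y =>
    if v.symm x < v.symm y then (if w.symm (v.symm x) < w.symm (v.symm y) then 1 else u x y)
    else if v.symm y < v.symm x then
      (if w.symm (v.symm y) < w.symm (v.symm x) then 1 else u y x)
    else 1
  have hF (x y : Fin n) : F x y = F y x := by
    rcases lt_trichotomy (v.symm x) (v.symm y) with h | h | h <;> simp [F, h, h.not_gt]
  have reindex : invProd (fun i j => u (v i) (v j)) w = ∏ j, ∏ i ∈ Iio j, F i j := by
    rw [← prod_Iio_comp_of_symm hF v, invProd]
    refine prod_congr rfl fun j _ => prod_congr rfl fun i hi => ?_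
    simp [F, mem_Iio.mp hi]
  rw [reindex, invProd, invProd]
  simp only [← prod_mul_distrib]
  refine prod_congr rfl fun j _ => prod_congr rfl fun i hi => ?_
  have hij : i ≠ j := (mem_Iio.mp hi).ne
  have hsymm (x : Fin n) : (v * w).symm x = w.symm (v.symm x) := rfl
  have hw : w.symm (v.symm i) ≠ w.symm (v.symm j) := by simpa using hij
  rw [hsymm, hsymm]
  rcases lt_or_gt_of_ne (v.symm.injective.ne hij) with h | h <;>
    rcases lt_or_gt_of_ne hw with h' | h' <;>
    simp [F, h, h', h.not_gt, h'.not_gt, hu i j hij]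

lemma invProd_neg_one (w : Equiv.Perm (Fin n)) :
    invProd (fun _ _ => (-1 : ℤˣ)) w = Equiv.Perm.sign w := by
  rw [← Equiv.Perm.sign_symm, Equiv.Perm.sign_eq_prod_prod_Iio]
  rfl

end InversionProduct

section Twist

variable {n : ℕ} {k : Type*} [CommRing k]

/-- The torus element with entry `-1` at `i` and `1` elsewhere. -/
def torusNeg (i : Fin n) : Torus n := Pi.mulSingle i (-1)

lemma torusNeg_mul_self (i : Fin n) : torusNeg i * torusNeg i = 1 := by
  simp [torusNeg, ← Pi.mulSingle_mul]

lemma permAut_torusNeg (w : Equiv.Perm (Fin n)) (i : Fin n) :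
    permAut n w (torusNeg i) = torusNeg (w i) := by
  funext j
  change (Pi.mulSingle i (-1) : Torus n) (w.symm j) = (Pi.mulSingle (w i) (-1) : Torus n) j
  simp only [Pi.mulSingle_apply, Equiv.symm_apply_eq]

/-- The element `a ε_i + b ε_j` of the group algebra of the torus. -/
def twistUnit (a b : k) (i j : Fin n) : MonoidAlgebra k (Torus n) :=
  .single (torusNeg i) a + .single (torusNeg j) b

lemma twistUnit_comm (a b : k) (i j : Fin n) : twistUnit a b j i = twistUnit b a i j :=
  add_comm _ _

lemma twistUnit_mul_twistUnit {a b : k} (h : a ^ 2 + b ^ 2 = 0) (h' : 2 * (a * b) = 1)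
    (i j : Fin n) : twistUnit a b i j * twistUnit a b j i = 1 := by
  have hb : b * b = -(a * a) := by linear_combination h
  have hab : a * b + b * a = 1 := by linear_combination h'
  simp only [twistUnit, add_mul, mul_add, MonoidAlgebra.single_mul_single, torusNeg_mul_self,
    hb, mul_comm (torusNeg j) (torusNeg i), MonoidAlgebra.single_neg]
  rw [MonoidAlgebra.one_def, ← hab, MonoidAlgebra.single_add]
  abel

/-- The twisting cocycle on the symmetric group, with values in the group algebra of the torus. -/
def twistCocycle (a b : k) (w : Equiv.Perm (Fin n)) : MonoidAlgebra k (Torus n) :=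
  invProd (twistUnit a b) w

/-- The permutation action on the group algebra of the torus. -/
def torusAlgAct (k : Type*) [CommRing k] (w : Equiv.Perm (Fin n)) :
    MonoidAlgebra k (Torus n) →ₐ[k] MonoidAlgebra k (Torus n) :=
  MonoidAlgebra.mapDomainAlgHom k k (permAut n w : Torus n →* Torus n)

/-- The inclusion of the group algebra of the torus into that of `𝔾ₙ`. -/
def torusAlgIncl (k : Type*) [CommRing k] (n : ℕ) :
    MonoidAlgebra k (Torus n) →ₐ[k] MonoidAlgebra k (Gn n) :=
  MonoidAlgebra.mapDomainAlgHom k k SemidirectProduct.inl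

lemma torusAlgAct_twistUnit (a b : k) (w : Equiv.Perm (Fin n)) (i j : Fin n) :
    torusAlgAct k w (twistUnit a b i j) = twistUnit a b (w i) (w j) := by
  simp [torusAlgAct, twistUnit, MonoidAlgebra.mapDomain_add, permAut_torusNeg]

lemma twistCocycle_mul {a b : k} (h : a ^ 2 + b ^ 2 = 0) (h' : 2 * (a * b) = 1)
    (v w : Equiv.Perm (Fin n)) :
    twistCocycle a b (v * w) = twistCocycle a b v * torusAlgAct k v (twistCocycle a b w) := by
  have hmap := map_invProd (torusAlgAct k v : _ →* MonoidAlgebra k (Torus n)) (twistUnit a b) w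
  simp only [MonoidHom.coe_coe, torusAlgAct_twistUnit] at hmap
  rw [twistCocycle, twistCocycle, twistCocycle, hmap,
    invProd_mul fun i j _ => twistUnit_mul_twistUnit h h' i j]

lemma twistCocycle_mul_swap {a b : k} (h : a ^ 2 + b ^ 2 = 0) (h' : 2 * (a * b) = 1)
    (w : Equiv.Perm (Fin n)) : twistCocycle a b w * twistCocycle b a w = 1 := by
  refine invProd_mul_invProd_eq_one (fun i j _ => ?_) w
  rw [← twistUnit_comm a b]
  exact twistUnit_mul_twistUnit h h' i j

lemma of_mul_torusAlgIncl (g : Gn n) (x : MonoidAlgebra k (Torus n)) :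
    MonoidAlgebra.of k (Gn n) g * torusAlgIncl k n x =
      torusAlgIncl k n (torusAlgAct k g.right x) * MonoidAlgebra.of k (Gn n) g := by
  induction x using MonoidAlgebra.induction_on with
  | of t =>
    have hcomm : g * SemidirectProduct.inl t =
        SemidirectProduct.inl (permAut n g.right t) * g := by
      ext1 <;> simp [mul_comm]
    simp [torusAlgIncl, torusAlgAct, MonoidAlgebra.single_mul_single, hcomm]
  | add x y hx hy => simp only [map_add, mul_add, add_mul, hx, hy]
  | smul r x hx => simp only [map_smul, mul_smul_comm, smul_mul_assoc, hx]

/-- The twisting endomorphism of the group algebra of `𝔾ₙ`. -/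
def twistHom {a b : k} (h : a ^ 2 + b ^ 2 = 0) (h' : 2 * (a * b) = 1) (n : ℕ) :
    MonoidAlgebra k (Gn n) →ₐ[k] MonoidAlgebra k (Gn n) :=
  MonoidAlgebra.lift k (MonoidAlgebra k (Gn n)) (Gn n)
    { toFun := fun g => torusAlgIncl k n (twistCocycle a b g.right) * MonoidAlgebra.of k (Gn n) g
      map_one' := by simp [twistCocycle, invProd_one, ← MonoidAlgebra.one_def]
      map_mul' := fun g g' => by
        rw [SemidirectProduct.mul_right, twistCocycle_mul h h', map_mul, map_mul, mul_assoc,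
          mul_assoc, ← mul_assoc _ (MonoidAlgebra.of k (Gn n) g), ← of_mul_torusAlgIncl,
          mul_assoc] }

lemma twistHom_of {a b : k} (h : a ^ 2 + b ^ 2 = 0) (h' : 2 * (a * b) = 1) (g : Gn n) :
    twistHom h h' n (MonoidAlgebra.of k (Gn n) g) =
      torusAlgIncl k n (twistCocycle a b g.right) * MonoidAlgebra.of k (Gn n) g :=
  MonoidAlgebra.lift_of _ _

lemma twistHom_torusAlgIncl {a b : k} (h : a ^ 2 + b ^ 2 = 0) (h' : 2 * (a * b) = 1)
    (x : MonoidAlgebra k (Torus n)) :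
    twistHom h h' n (torusAlgIncl k n x) = torusAlgIncl k n x := by
  have hcomp : (twistHom h h' n).comp (torusAlgIncl k n) = torusAlgIncl k n := by
    refine MonoidAlgebra.algHom_ext (fun t => ?_) (by ext)
    have ht : torusAlgIncl k n (.single t 1) =
        MonoidAlgebra.of k (Gn n) (SemidirectProduct.inl t) := by
      simp [torusAlgIncl]
    rw [AlgHom.comp_apply, ht, twistHom_of]
    simp [twistCocycle, invProd_one]
  exact DFunLike.congr_fun hcomp x

lemma twistHom_comp_swap {a b : k} (h : a ^ 2 + b ^ 2 = 0) (h' : 2 * (a * b) = 1)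
    (hs : b ^ 2 + a ^ 2 = 0) (hs' : 2 * (b * a) = 1) (n : ℕ) :
    (twistHom h h' n).comp (twistHom hs hs' n) = AlgHom.id k _ := by
  refine MonoidAlgebra.algHom_ext (fun g => ?_) (by ext)
  change twistHom h h' n (twistHom hs hs' n (MonoidAlgebra.of k (Gn n) g)) =
    MonoidAlgebra.of k (Gn n) g
  rw [twistHom_of, map_mul, twistHom_torusAlgIncl, twistHom_of, ← mul_assoc, ← map_mul,
    twistCocycle_mul_swap hs hs', map_one, one_mul]

/-- The span of the torus elements with entries `±1` whose product is `s`. -/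
def signSpan (k : Type*) [CommRing k] (n : ℕ) (s : ℤˣ) : Submodule k (MonoidAlgebra k (Torus n)) :=
  Submodule.span k (MonoidAlgebra.of k (Torus n) ''
    {t | (∀ i, t i = 1 ∨ t i = -1) ∧ ∏ i, t i = Units.map (Int.castRingHom ℂ).toMonoidHom s})

lemma one_mem_signSpan : (1 : MonoidAlgebra k (Torus n)) ∈ signSpan k n 1 :=
  Submodule.subset_span ⟨1, by simp, map_one _⟩

lemma mul_mem_signSpan {s s' : ℤˣ} {x y : MonoidAlgebra k (Torus n)} (hx : x ∈ signSpan k n s)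
    (hy : y ∈ signSpan k n s') : x * y ∈ signSpan k n (s * s') := by
  have hxy := Submodule.mul_mem_mul hx hy
  rw [signSpan, signSpan, Submodule.span_mul_span] at hxy
  refine Submodule.span_mono ?_ hxy
  rintro _ ⟨_, ⟨t, ⟨ht, htp⟩, rfl⟩, _, ⟨t', ⟨ht', htp'⟩, rfl⟩, rfl⟩
  refine ⟨t * t', ⟨fun i => ?_, ?_⟩, map_mul _ _ _⟩
  · rcases ht i with h | h <;> rcases ht' i with h' | h' <;> simp [h, h']
  · simp only [Pi.mul_apply, prod_mul_distrib, htp, htp', map_mul]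

lemma prod_mem_signSpan {ι : Type*} (S : Finset ι) {s : ι → ℤˣ}
    {x : ι → MonoidAlgebra k (Torus n)} (h : ∀ i ∈ S, x i ∈ signSpan k n (s i)) :
    ∏ i ∈ S, x i ∈ signSpan k n (∏ i ∈ S, s i) := by
  classical
  induction S using Finset.induction_on with
  | empty => exact one_mem_signSpan
  | insert i S hi ih =>
    rw [prod_insert hi, prod_insert hi]
    exact mul_mem_signSpan (h i (mem_insert_self i S))
      (ih fun j hj => h j (mem_insert_of_mem hj))

lemma twistUnit_mem_signSpan (a b : k) (i j : Fin n) : twistUnit a b i j ∈ signSpan k n (-1) := by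
  have hmem (l : Fin n) (c : k) : MonoidAlgebra.single (torusNeg l) c ∈ signSpan k n (-1) := by
    have hsmul : MonoidAlgebra.single (torusNeg l) c =
        c • MonoidAlgebra.of k (Torus n) (torusNeg l) := by simp
    rw [hsmul]
    refine Submodule.smul_mem _ _ (Submodule.subset_span ⟨_, ⟨fun i => ?_, ?_⟩, rfl⟩)
    · by_cases hi : i = l <;> simp [torusNeg, hi]
    · rw [torusNeg, Finset.prod_pi_mulSingle']
      ext
      simp
  exact add_mem (hmem i a) (hmem j b)

lemma twistCocycle_mem_signSpan (a b : k) (w : Equiv.Perm (Fin n)) :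
    twistCocycle a b w ∈ signSpan k n (Equiv.Perm.sign w) := by
  rw [← invProd_neg_one]
  refine prod_mem_signSpan _ fun j _ => prod_mem_signSpan _ fun i _ => ?_
  split_ifs
  · exact one_mem_signSpan
  · exact twistUnit_mem_signSpan a b i j

/-- The group algebra of a subgroup of `𝔾ₙ`, as a subalgebra of the group algebra of `𝔾ₙ`. -/
def subgroupAlgIncl (k : Type*) [CommRing k] (H : Subgroup (Gn n)) :
    MonoidAlgebra k H →ₐ[k] MonoidAlgebra k (Gn n) :=
  MonoidAlgebra.mapDomainAlgHom k k H.subtype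

lemma subgroupAlgIncl_injective (H : Subgroup (Gn n)) :
    Function.Injective (subgroupAlgIncl k H) :=
  MonoidAlgebra.mapDomain_injective H.subtype_injective

lemma of_mem_range_subgroupAlgIncl {H : Subgroup (Gn n)} {g : Gn n} (hg : g ∈ H) :
    MonoidAlgebra.of k (Gn n) g ∈ (subgroupAlgIncl k H).range :=
  ⟨MonoidAlgebra.of k H ⟨g, hg⟩, by simp [subgroupAlgIncl]⟩

/-- Sufficient condition for the twist to carry the group algebra of `H` into that of `K`. -/
lemma map_twistHom_le {a b : k} (h : a ^ 2 + b ^ 2 = 0) (h' : 2 * (a * b) = 1)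
    {H K : Subgroup (Gn n)}
    (hHK : ∀ g ∈ H, ∀ t : Torus n, (∀ i, t i = 1 ∨ t i = -1) → ∏ i, t i = sgn n g.right →
      SemidirectProduct.inl t * g ∈ K) :
    (subgroupAlgIncl k H).range.map (twistHom h h' n) ≤ (subgroupAlgIncl k K).range := by
  rintro _ ⟨_, ⟨x, rfl⟩, rfl⟩
  change twistHom h h' n (subgroupAlgIncl k H x) ∈ _
  induction x using MonoidAlgebra.induction_on with
  | of g =>
    have hg : subgroupAlgIncl k H (MonoidAlgebra.of k H g) = MonoidAlgebra.of k (Gn n) g := by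
      simp [subgroupAlgIncl]
    rw [hg, twistHom_of]
    have hc := twistCocycle_mem_signSpan a b (g : Gn n).right
    refine Submodule.span_induction (p := fun y _ => torusAlgIncl k n y *
      MonoidAlgebra.of k (Gn n) g ∈ (subgroupAlgIncl k K).range) ?_ ?_ ?_ ?_ hc
    · rintro _ ⟨t, ⟨ht, htp⟩, rfl⟩
      have hof : torusAlgIncl k n (MonoidAlgebra.of k (Torus n) t) =
          MonoidAlgebra.of k (Gn n) (SemidirectProduct.inl t) := by
        simp [torusAlgIncl]
      rw [hof, ← map_mul]
      exact of_mem_range_subgroupAlgIncl (hHK g g.2 t ht htp)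
    · simp
    · intro y z _ _ hy hz
      rw [map_add, add_mul]
      exact add_mem hy hz
    · intro r y _ hy
      rw [map_smul, smul_mul_assoc]
      exact Subalgebra.smul_mem _ hy r
  | add x y hx hy =>
    rw [map_add, map_add]
    exact add_mem hx hy
  | smul r x hx =>
    rw [map_smul, map_smul]
    exact Subalgebra.smul_mem _ hx r

lemma sgn_mul_self (w : Equiv.Perm (Fin n)) : sgn n w * sgn n w = 1 := by
  rw [← map_mul, sgn, MonoidHom.comp_apply, map_mul, Int.units_mul_self, map_one]

lemma detT_inl_mul (t : Torus n) (g : Gn n) :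
    detT n (SemidirectProduct.inl t * g) = (∏ i, t i) * detT n g := by
  rw [map_mul]
  rfl

lemma detC_apply (g : Gn n) : detC n g = sgn n g.right * detT n g := rfl

lemma inl_mul_mem_torusSub {C : Subgroup ℂˣ} (hC : -1 ∈ C) {t : Torus n}
    (ht : ∀ i, t i = 1 ∨ t i = -1) {g : Gn n} (hg : g ∈ TorusSub n C) :
    SemidirectProduct.inl t * g ∈ TorusSub n C := by
  refine mul_mem (fun i => ?_) hg
  rcases ht i with h | h
  · simp [h]
  · simpa [h] using hC

/-- If `-1 ∈ C`, the group algebras of `GG n C C'` and `WW n C C'` are isomorphic over every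
commutative ring with elements `a`, `b` such that `a² + b² = 0` and `2ab = 1`. -/
theorem nonempty_algEquiv_GG_WW {a b : k} (h : a ^ 2 + b ^ 2 = 0) (h' : 2 * (a * b) = 1)
    {C : Subgroup ℂˣ} (hC : -1 ∈ C) (C' : Subgroup ℂˣ) :
    Nonempty (MonoidAlgebra k (GG n C C') ≃ₐ[k] MonoidAlgebra k (WW n C C')) := by
  have hs : b ^ 2 + a ^ 2 = 0 := by rw [add_comm, h]
  have hs' : 2 * (b * a) = 1 := by rw [mul_comm b, h']
  let e : MonoidAlgebra k (Gn n) ≃ₐ[k] MonoidAlgebra k (Gn n) :=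
    AlgEquiv.ofAlgHom (twistHom h h' n) (twistHom hs hs' n)
      (twistHom_comp_swap h h' hs hs' n) (twistHom_comp_swap hs hs' h h' n)
  have hGW : (subgroupAlgIncl k (GG n C C')).range.map (twistHom h h' n) ≤
      (subgroupAlgIncl k (WW n C C')).range := by
    refine map_twistHom_le h h' fun g hg t ht htp => ⟨inl_mul_mem_torusSub hC ht hg.1, ?_⟩
    change detC n _ ∈ C'
    rw [detC_apply, detT_inl_mul, htp, SemidirectProduct.mul_right, SemidirectProduct.right_inl,
      one_mul, ← mul_assoc, sgn_mul_self, one_mul]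
    exact hg.2
  have hWG : (subgroupAlgIncl k (WW n C C')).range.map (twistHom hs hs' n) ≤
      (subgroupAlgIncl k (GG n C C')).range := by
    refine map_twistHom_le hs hs' fun g hg t ht htp => ⟨inl_mul_mem_torusSub hC ht hg.1, ?_⟩
    change detT n _ ∈ C'
    rw [detT_inl_mul, htp, ← detC_apply]
    exact hg.2
  have heq : (subgroupAlgIncl k (GG n C C')).range.map (e : _ →ₐ[k] MonoidAlgebra k (Gn n)) =
      (subgroupAlgIncl k (WW n C C')).range := by
    refine le_antisymm hGW fun x hx => ?_
    exact ⟨e.symm x, hWG ⟨x, hx, rfl⟩, e.apply_symm_apply x⟩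
  exact ⟨(AlgEquiv.ofInjective _ (subgroupAlgIncl_injective _)).trans <|
    (e.subalgebraMap _).trans <| (Subalgebra.equivOfEq _ _ heq).trans
    (AlgEquiv.ofInjective _ (subgroupAlgIncl_injective _)).symm⟩

end Twist

/-- Theorem B: the group rings of `G(m,p,n)` and `W(m,p,n)` over `R = ℤ[(1+i)/2]` are
isomorphic; in particular so are the complex group algebras. -/
theorem groupAlgebra_iso (n m p : ℕ) (hn : 2 ≤ n) (hm : 0 < m) (hme : Even m) (hpm : p ∣ m) :
    Nonempty
      (MonoidAlgebra Rring (Gmpn m p n) ≃ₐ[Rring] MonoidAlgebra Rring (Wmpn m p n)) ∧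
    Nonempty
      (MonoidAlgebra ℂ (Gmpn m p n) ≃ₐ[ℂ] MonoidAlgebra ℂ (Wmpn m p n)) := by
  have hC : (-1 : ℂˣ) ∈ Cgrp m := hme.neg_one_pow
  have hsq : ((1 + Complex.I) / 2) ^ 2 + (1 - (1 + Complex.I) / 2) ^ 2 = 0 := by
    linear_combination (1 / 2 : ℂ) * Complex.I_sq
  have hmul : 2 * ((1 + Complex.I) / 2 * (1 - (1 + Complex.I) / 2)) = 1 := by
    linear_combination (-1 / 2 : ℂ) * Complex.I_sq
  let a : Rring := ⟨(1 + Complex.I) / 2, Algebra.subset_adjoin rfl⟩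
  exact ⟨nonempty_algEquiv_GG_WW (a := a) (b := 1 - a) (Subtype.ext hsq) (Subtype.ext hmul) hC _,
    nonempty_algEquiv_GG_WW hsq hmul hC _⟩

end
end

section
/- Let n ≥ 2, let m be a positive integer, and let G be a thick subgroup of Cₘⁿ ⋊ Sₙ. Then there exists a subgroup C' of Cₘ such that {t : Fin n → ℂˣ | (t, 1) ∈ G} = {t | (∀ i, t i ∈ Cₘ) ∧ ∏ i, t i ∈ C'}. -/
open MvPolynomial Finset

noncomputable section

/-- The group `Cₘⁿ ⋊ Sₙ = G(m,1,n)` as a subgroup of `𝔾ₙ`. -/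
def CmSn (n m : ℕ) : Subgroup (Gn n) := TorusSub n (Cgrp m)

/-- A subgroup `G` of `Cₘⁿ ⋊ Sₙ` is thick if it is normal in `Cₘⁿ ⋊ Sₙ` and the projection
`(t,w) ↦ w` maps `G` onto the symmetric group. -/
def IsThick (n m : ℕ) (G : Subgroup (Gn n)) : Prop :=
  G ≤ CmSn n m ∧ (∀ x ∈ CmSn n m, ∀ g ∈ G, x * g * x⁻¹ ∈ G) ∧
    ∀ w : Equiv.Perm (Fin n), ∃ g ∈ G, g.right = w

/-- Since the normal factor is commutative, the whole semidirect product acts on it by conjugation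
through its right component. -/
lemma SemidirectProduct.conj_inl_of_comm {N H : Type*} [CommGroup N] [Group H]
    {φ : H →* MulAut N} (g : N ⋊[φ] H) (a : N) :
    g * inl a * g⁻¹ = inl (φ g.right a) := by
  conv_lhs => rw [← inl_left_mul_inr_right g]
  rw [mul_inv_rev, ← map_inv inr]
  calc inl g.left * inr g.right * inl a * (inr g.right⁻¹ * (inl g.left)⁻¹)
      = inl g.left * (inr g.right * inl a * inr g.right⁻¹) * (inl g.left)⁻¹ := by
        simp only [mul_assoc]
    _ = inl (φ g.right a) := by
        rw [← inl_aut, ← map_inv, ← map_mul, ← map_mul, mul_inv_cancel_comm]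

lemma permAut_swap_mulSingle {n : ℕ} (i j : Fin n) (c : ℂˣ) :
    permAut n (Equiv.swap i j) (Pi.mulSingle i c) = Pi.mulSingle j c := by
  funext k
  change (Pi.mulSingle i c : Torus n) ((Equiv.swap i j).symm k) = _
  simp only [Pi.mulSingle_apply, Equiv.symm_swap, Equiv.swap_apply_eq_iff, Equiv.swap_apply_left]

lemma inl_mulSingle_mul_mulSingle_inv_mem {n m : ℕ} {G : Subgroup (Gn n)} (hG : IsThick n m G)
    (i j : Fin n) {c : ℂˣ} (hc : c ∈ Cgrp m) :
    (SemidirectProduct.inl (Pi.mulSingle i c * Pi.mulSingle j c⁻¹) : Gn n) ∈ G := by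
  obtain ⟨-, hnorm, hsurj⟩ := hG
  obtain ⟨g, hg, hgr⟩ := hsurj (Equiv.swap i j)
  have hx : (SemidirectProduct.inl (Pi.mulSingle i c) : Gn n) ∈ CmSn n m := by
    intro k
    by_cases hk : k = i
    · subst hk
      simpa using hc
    · simp [hk, one_mem]
  have hmem := G.mul_mem (hnorm _ hx g hg) (G.inv_mem hg)
  rwa [mul_assoc, mul_assoc, ← mul_assoc g, ← map_inv, ← Pi.mulSingle_inv,
    SemidirectProduct.conj_inl_of_comm, hgr, permAut_swap_mulSingle, ← map_mul] at hmem

/-- Modulo the torus part of a thick subgroup, a tuple in `Cₘⁿ` is congruent to the tuple whose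
only nontrivial entry is its product, placed at any chosen index. -/
lemma inl_mem_iff_inl_mulSingle_prod_mem {n m : ℕ} {G : Subgroup (Gn n)} (hG : IsThick n m G)
    (j : Fin n) {t : Torus n} (ht : ∀ i, t i ∈ Cgrp m) :
    (SemidirectProduct.inl t : Gn n) ∈ G ↔
      (SemidirectProduct.inl (Pi.mulSingle j (∏ i, t i)) : Gn n) ∈ G := by
  have hprod : ∏ i, (Pi.mulSingle i (t i) * Pi.mulSingle j (t i)⁻¹ : Torus n) =
      t * (Pi.mulSingle j (∏ i, t i))⁻¹ := by
    rw [Finset.prod_mul_distrib, Finset.univ_prod_mulSingle, ← Pi.mulSingle_inv,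
      ← Finset.prod_inv_distrib]
    congr 1
    exact (map_prod (MonoidHom.mulSingle (fun _ : Fin n => ℂˣ) j) _ _).symm
  have hquot : t * (Pi.mulSingle j (∏ i, t i))⁻¹ ∈ G.comap SemidirectProduct.inl := by
    rw [← hprod]
    exact Subgroup.prod_mem _ fun i _ => inl_mulSingle_mul_mulSingle_inv_mem hG i j (ht i)
  rw [← Subgroup.mem_comap, ← Subgroup.mem_comap]
  constructor
  · intro h
    simpa using mul_mem (inv_mem hquot) h
  · intro h
    simpa using mul_mem hquot h

/-- Lemma 3.5: the torus part of a thick subgroup `G` of `Cₘⁿ ⋊ Sₙ` is of the form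
`T_{C,C'} = {t ∈ Cₘⁿ : ∏ i, t i ∈ C'}` for some subgroup `C' ⊆ Cₘ`. -/
theorem thick_torus_part (n m : ℕ) (hn : 2 ≤ n) (hm : 0 < m)
    (G : Subgroup (Gn n)) (hG : IsThick n m G) :
    ∃ C' : Subgroup ℂˣ, C' ≤ Cgrp m ∧
      {t : Torus n | (⟨t, 1⟩ : Gn n) ∈ G} =
        {t : Torus n | (∀ i, t i ∈ Cgrp m) ∧ (∏ i, t i) ∈ C'} := by
  let j : Fin n := ⟨0, by omega⟩
  refine ⟨Cgrp m ⊓ (G.comap SemidirectProduct.inl).comap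
    (MonoidHom.mulSingle (fun _ : Fin n => ℂˣ) j), inf_le_left, ?_⟩
  ext t
  constructor
  · intro h
    have ht : ∀ i, t i ∈ Cgrp m := hG.1 h
    exact ⟨ht, Subgroup.prod_mem _ fun i _ => ht i,
      (inl_mem_iff_inl_mulSingle_prod_mem hG j ht).1 h⟩
  · rintro ⟨ht, -, h⟩
    exact (inl_mem_iff_inl_mulSingle_prod_mem hG j ht).2 h

end
end
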